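/- Let g be smooth on Ω and let z ∈ C³(Ω). Then for j = 1, 2 the pointwise identity Σ_i ∇_i b^{ij} = −K · Σ_l g^{jl} ∂_l z holds on Ω, where K is the Gaussian curvature of g. -/

import Mathlib

open Real Set Filter Topology

noncomputable section

/-- Partial derivative of `f : ℝ × ℝ → ℝ` in coordinate direction `i`. -/
def pd (i : Fin 2) (f : ℝ × ℝ → ℝ) (p : ℝ × ℝ) : ℝ :=
  fderiv ℝ f p (if i = 0 then (1, 0) else (0, 1))

/-- The metric components as a 2×2 symmetric matrix of functions. -/
def gmat (g11 g12 g22 : ℝ × ℝ → ℝ) (i j : Fin 2) : ℝ × ℝ → ℝ :=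
  if i = 0 then (if j = 0 then g11 else g12) else (if j = 0 then g12 else g22)

/-- The determinant of the metric. -/
def gdet (g11 g12 g22 : ℝ × ℝ → ℝ) (p : ℝ × ℝ) : ℝ :=
  g11 p * g22 p - g12 p ^ 2

/-- Components of the inverse metric. -/
def ginv (g11 g12 g22 : ℝ × ℝ → ℝ) (i j : Fin 2) (p : ℝ × ℝ) : ℝ :=
  (if i = 0 then (if j = 0 then g22 p else -g12 p)
   else (if j = 0 then -g12 p else g11 p)) / gdet g11 g12 g22 p

/-- Christoffel symbols Γˡ_{ij}. -/
def Chr (g11 g12 g22 : ℝ × ℝ → ℝ) (l i j : Fin 2) (p : ℝ × ℝ) : ℝ :=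
  (1 / 2) * ∑ m : Fin 2, ginv g11 g12 g22 l m p *
    (pd i (gmat g11 g12 g22 j m) p + pd j (gmat g11 g12 g22 i m) p
      - pd m (gmat g11 g12 g22 i j) p)

/-- Second covariant derivatives ∇_{ij} z. -/
def cov2 (g11 g12 g22 z : ℝ × ℝ → ℝ) (i j : Fin 2) (p : ℝ × ℝ) : ℝ :=
  pd i (pd j z) p - ∑ l : Fin 2, Chr g11 g12 g22 l i j p * pd l z p

/-- |∇_g z|². -/
def gradSq (g11 g12 g22 z : ℝ × ℝ → ℝ) (p : ℝ × ℝ) : ℝ :=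
  ∑ i : Fin 2, ∑ j : Fin 2, ginv g11 g12 g22 i j p * pd i z p * pd j z p

/-- The Gaussian curvature of the metric g. -/
def GaussK (g11 g12 g22 : ℝ × ℝ → ℝ) (p : ℝ × ℝ) : ℝ :=
  (1 / gdet g11 g12 g22 p) * ∑ i : Fin 2, gmat g11 g12 g22 0 i p *
    (pd 0 (Chr g11 g12 g22 i 1 1) p - pd 1 (Chr g11 g12 g22 i 0 1) p
      + ∑ j : Fin 2, (Chr g11 g12 g22 j 1 1 p * Chr g11 g12 g22 i j 0 p
          - Chr g11 g12 g22 j 0 1 p * Chr g11 g12 g22 i j 1 p))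

/-- Darboux's equation at a point p. -/
def DarbouxEq (g11 g12 g22 z : ℝ × ℝ → ℝ) (p : ℝ × ℝ) : Prop :=
  cov2 g11 g12 g22 z 0 0 p * cov2 g11 g12 g22 z 1 1 p
      - cov2 g11 g12 g22 z 0 1 p * cov2 g11 g12 g22 z 1 0 p
    = GaussK g11 g12 g22 p * gdet g11 g12 g22 p * (1 - gradSq g11 g12 g22 z p)

/-- A smooth Riemannian metric on Ω. -/
def IsMetricOn (g11 g12 g22 : ℝ × ℝ → ℝ) (Ω : Set (ℝ × ℝ)) : Prop :=
  ContDiffOn ℝ (⊤ : ℕ∞) g11 Ω ∧ ContDiffOn ℝ (⊤ : ℕ∞) g12 Ω ∧ ContDiffOn ℝ (⊤ : ℕ∞) g22 Ω ∧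
  ∀ p ∈ Ω, 0 < g11 p ∧ 0 < gdet g11 g12 g22 p

/-- The centers q_n = (1/n, 0). -/
def qpt (n : ℕ) : ℝ × ℝ := (1 / (n : ℝ), 0)

/-- Half-width of the square Xⁿ (whose width is 1/(2n(n+1))). -/
def halfw (n : ℕ) : ℝ := 1 / (4 * (n : ℝ) * ((n : ℝ) + 1))

/-- The open axis-parallel square Xⁿ centered at q_n of width 1/(2n(n+1)). -/
def sqX (n : ℕ) : Set (ℝ × ℝ) :=
  {p | |p.1 - 1 / (n : ℝ)| < halfw n ∧ |p.2| < halfw n}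

/-- The square X = (-1,1) × (-1,1). -/
def Xset : Set (ℝ × ℝ) := Ioo (-1 : ℝ) 1 ×ˢ Ioo (-1 : ℝ) 1

/-- φ is C^∞ on the closure of X, vanishes to infinite order on ∂X, and has a sign on X. -/
def PhiAdmissible (φ : ℝ × ℝ → ℝ) : Prop :=
  ContDiffOn ℝ (⊤ : ℕ∞) φ (closure Xset) ∧
  (∀ k : ℕ, ∀ p ∈ frontier Xset, iteratedFDerivWithin ℝ k φ (closure Xset) p = 0) ∧
  ((∀ p ∈ Xset, 0 < φ p) ∨ (∀ p ∈ Xset, φ p < 0))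

/-- K is obtained from φ and the sequence γ by the construction of the paper. -/
def Kconstr (φ : ℝ × ℝ → ℝ) (γ : ℕ → ℝ) (K : ℝ × ℝ → ℝ) : Prop :=
  (∀ n : ℕ, 1 ≤ n → ∀ q ∈ closure (sqX n),
      K q = γ n * φ ((4 * (n : ℝ) * ((n : ℝ) + 1)) • (q - qpt n))) ∧
  (∀ q : ℝ × ℝ, q ∉ ⋃ n ∈ {m : ℕ | 1 ≤ m}, sqX n → K q = 0)

/-- Right vertical side +v_n of ∂Xⁿ. -/
def vSideR (n : ℕ) : Set (ℝ × ℝ) :=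
  {p | p.1 = 1 / (n : ℝ) + halfw n ∧ |p.2| ≤ halfw n}

/-- Left vertical side -v_n of ∂Xⁿ. -/
def vSideL (n : ℕ) : Set (ℝ × ℝ) :=
  {p | p.1 = 1 / (n : ℝ) - halfw n ∧ |p.2| ≤ halfw n}

/-- Top horizontal side +h_n of ∂Xⁿ. -/
def hSideT (n : ℕ) : Set (ℝ × ℝ) :=
  {p | p.2 = halfw n ∧ |p.1 - 1 / (n : ℝ)| ≤ halfw n}

/-- Bottom horizontal side -h_n of ∂Xⁿ. -/
def hSideB (n : ℕ) : Set (ℝ × ℝ) :=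
  {p | p.2 = -halfw n ∧ |p.1 - 1 / (n : ℝ)| ≤ halfw n}

/-- At the point p there is a C³ change of coordinates Φ(x,y) = (x - p¹, s(x,y)) on a
neighborhood U ⊆ Ω of p, a C² function u and a positive continuous f on Φ(U), solving
∂_tt u + (K ∘ Φ⁻¹) ∂_ss u = (K ∘ Φ⁻¹) f on Φ(U). -/
def GoodChartAt (K : ℝ × ℝ → ℝ) (Ω : Set (ℝ × ℝ)) (p : ℝ × ℝ) : Prop :=
  ∃ (U : Set (ℝ × ℝ)) (s : ℝ × ℝ → ℝ) (Ψ : ℝ × ℝ → ℝ × ℝ) (u f : ℝ × ℝ → ℝ),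
    IsOpen U ∧ p ∈ U ∧ U ⊆ Ω ∧ ContDiffOn ℝ 3 s U ∧
    IsOpen ((fun q => (q.1 - p.1, s q)) '' U) ∧
    ContDiffOn ℝ 3 Ψ ((fun q => (q.1 - p.1, s q)) '' U) ∧
    (∀ q ∈ U, Ψ (q.1 - p.1, s q) = q) ∧
    (∀ w ∈ (fun q => (q.1 - p.1, s q)) '' U, ((Ψ w).1 - p.1, s (Ψ w)) = w) ∧
    ContDiffOn ℝ 2 u ((fun q => (q.1 - p.1, s q)) '' U) ∧
    ContinuousOn f ((fun q => (q.1 - p.1, s q)) '' U) ∧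
    (∀ w ∈ (fun q => (q.1 - p.1, s q)) '' U, 0 < f w) ∧
    (∀ w ∈ (fun q => (q.1 - p.1, s q)) '' U,
      pd 0 (pd 0 u) w + K (Ψ w) * pd 1 (pd 1 u) w = K (Ψ w) * f w)


/-- Components of the contravariant 2-tensor b. -/
def bmat (g11 g12 g22 z : ℝ × ℝ → ℝ) (i j : Fin 2) (p : ℝ × ℝ) : ℝ :=
  (if i = 0 then (if j = 0 then cov2 g11 g12 g22 z 1 1 p else -cov2 g11 g12 g22 z 0 1 p)
   else (if j = 0 then -cov2 g11 g12 g22 z 0 1 p else cov2 g11 g12 g22 z 0 0 p))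
    / gdet g11 g12 g22 p

/-- The covariant divergence ∇_i b^{ij} (summed over i). -/
def divb (g11 g12 g22 z : ℝ × ℝ → ℝ) (j : Fin 2) (p : ℝ × ℝ) : ℝ :=
  ∑ i : Fin 2, (pd i (bmat g11 g12 g22 z i j) p
    + ∑ l : Fin 2, Chr g11 g12 g22 i i l p * bmat g11 g12 g22 z l j p
    + ∑ l : Fin 2, Chr g11 g12 g22 j i l p * bmat g11 g12 g22 z i l p)

section Partial

variable {Ω : Set (ℝ × ℝ)} {f h : ℝ × ℝ → ℝ} {p : ℝ × ℝ}

lemma pd_add (k : Fin 2) (hf : DifferentiableAt ℝ f p) (hh : DifferentiableAt ℝ h p) :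
    pd k (fun q => f q + h q) p = pd k f p + pd k h p := by
  simp [pd, fderiv_fun_add hf hh]

lemma pd_sub (k : Fin 2) (hf : DifferentiableAt ℝ f p) (hh : DifferentiableAt ℝ h p) :
    pd k (fun q => f q - h q) p = pd k f p - pd k h p := by
  simp [pd, fderiv_fun_sub hf hh]

lemma pd_neg (k : Fin 2) : pd k (fun q => -f q) p = -pd k f p := by
  simp [pd, fderiv_fun_neg]

lemma pd_mul (k : Fin 2) (hf : DifferentiableAt ℝ f p) (hh : DifferentiableAt ℝ h p) :
    pd k (fun q => f q * h q) p = pd k f p * h p + f p * pd k h p := by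
  simp only [pd, fderiv_fun_mul hf hh, add_apply, smul_apply, smul_eq_mul]
  ring

lemma pd_const_mul (k : Fin 2) (c : ℝ) (hf : DifferentiableAt ℝ f p) :
    pd k (fun q => c * f q) p = c * pd k f p := by
  simp [pd, fderiv_const_mul hf]

lemma pd_congr (k : Fin 2) (hΩ : IsOpen Ω) (hp : p ∈ Ω) (hfh : ∀ q ∈ Ω, f q = h q) :
    pd k f p = pd k h p := by
  have : f =ᶠ[𝓝 p] h := by
    filter_upwards [hΩ.mem_nhds hp] with q hq using hfh q hq
  rw [pd, pd, this.fderiv_eq]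

lemma ContDiffOn.pd {m n : WithTop ℕ∞} (hf : ContDiffOn ℝ n f Ω) (hΩ : IsOpen Ω)
    (hmn : m + 1 ≤ n) (k : Fin 2) : ContDiffOn ℝ m (pd k f) Ω :=
  (hf.fderiv_of_isOpen hΩ hmn).clm_apply contDiffOn_const

lemma ContDiffOn.differentiableAt_of_mem {n : WithTop ℕ∞} (hf : ContDiffOn ℝ n f Ω)
    (hΩ : IsOpen Ω) (hn : n ≠ 0) (hp : p ∈ Ω) : DifferentiableAt ℝ f p :=
  (hf.contDiffAt (hΩ.mem_nhds hp)).differentiableAt hn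

lemma pd_comm (hΩ : IsOpen Ω) (hf : ContDiffOn ℝ 2 f Ω) (hp : p ∈ Ω) (i j : Fin 2) :
    pd i (pd j f) p = pd j (pd i f) p := by
  have hd : DifferentiableAt ℝ (fderiv ℝ f) p :=
    ((hf.fderiv_of_isOpen (m := 1) hΩ (by norm_num)).contDiffAt
      (hΩ.mem_nhds hp)).differentiableAt one_ne_zero
  have hs : IsSymmSndFDerivAt ℝ f p :=
    (hf.contDiffAt (hΩ.mem_nhds hp)).isSymmSndFDerivAt (by simp)
  have key : ∀ k l : Fin 2, pd k (pd l f) p = fderiv ℝ (fderiv ℝ f) p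
      (if k = 0 then (1, 0) else (0, 1)) (if l = 0 then (1, 0) else (0, 1)) := by
    intro k l
    change fderiv ℝ (fun q => fderiv ℝ f q (if l = 0 then (1, 0) else (0, 1))) p _ = _
    rw [fderiv_clm_apply hd (differentiableAt_const _)]
    simp
  rw [key, key, hs]

end Partial

section Metric

variable {Ω : Set (ℝ × ℝ)} {g11 g12 g22 z : ℝ × ℝ → ℝ} {p : ℝ × ℝ}

/-- The component `R^l_{k01}` of the Riemann curvature tensor. -/
def riemann (g11 g12 g22 : ℝ × ℝ → ℝ) (l k : Fin 2) (p : ℝ × ℝ) : ℝ :=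
  pd 0 (Chr g11 g12 g22 l 1 k) p - pd 1 (Chr g11 g12 g22 l 0 k) p
    + ∑ j : Fin 2, (Chr g11 g12 g22 j 1 k p * Chr g11 g12 g22 l j 0 p
        - Chr g11 g12 g22 j 0 k p * Chr g11 g12 g22 l j 1 p)

lemma gmat_symm (i j : Fin 2) : gmat g11 g12 g22 i j = gmat g11 g12 g22 j i := by
  fin_cases i <;> fin_cases j <;> rfl

lemma Chr_symm (l i j : Fin 2) : Chr g11 g12 g22 l i j = Chr g11 g12 g22 l j i := by
  funext q
  simp only [Chr, gmat_symm i j, add_comm (pd i _ q)]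

lemma gdet_eq_gmat (q : ℝ × ℝ) : gdet g11 g12 g22 q =
    gmat g11 g12 g22 0 0 q * gmat g11 g12 g22 1 1 q - gmat g11 g12 g22 0 1 q ^ 2 := rfl

lemma IsMetricOn.contDiffOn_gmat (hg : IsMetricOn g11 g12 g22 Ω) (i j : Fin 2) :
    ContDiffOn ℝ 2 (gmat g11 g12 g22 i j) Ω := by
  obtain ⟨h1, h2, h3, -⟩ := hg
  have le : (2 : WithTop ℕ∞) ≤ ((⊤ : ℕ∞) : WithTop ℕ∞) := WithTop.coe_le_coe.2 le_top
  fin_cases i <;> fin_cases j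
  exacts [h1.of_le le, h2.of_le le, h2.of_le le, h3.of_le le]

lemma IsMetricOn.gdet_ne_zero (hg : IsMetricOn g11 g12 g22 Ω) (hp : p ∈ Ω) :
    gdet g11 g12 g22 p ≠ 0 :=
  (hg.2.2.2 p hp).2.ne'

lemma IsMetricOn.contDiffOn_gdet (hg : IsMetricOn g11 g12 g22 Ω) :
    ContDiffOn ℝ 2 (gdet g11 g12 g22) Ω :=
  ((hg.contDiffOn_gmat 0 0).mul (hg.contDiffOn_gmat 1 1)).sub ((hg.contDiffOn_gmat 0 1).pow 2)

lemma IsMetricOn.contDiffOn_ginv (hg : IsMetricOn g11 g12 g22 Ω) (i j : Fin 2) :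
    ContDiffOn ℝ 2 (ginv g11 g12 g22 i j) Ω := by
  refine ContDiffOn.div ?_ hg.contDiffOn_gdet fun q hq => hg.gdet_ne_zero hq
  have h1 := hg.contDiffOn_gmat 0 0
  have h2 := (hg.contDiffOn_gmat 0 1).neg
  have h3 := hg.contDiffOn_gmat 1 1
  fin_cases i <;> fin_cases j
  exacts [h3, h2, h2, h1]

lemma IsMetricOn.contDiffOn_Chr (hΩ : IsOpen Ω) (hg : IsMetricOn g11 g12 g22 Ω)
    (l i j : Fin 2) : ContDiffOn ℝ 1 (Chr g11 g12 g22 l i j) Ω := by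
  have hpd : ∀ k a b, ContDiffOn ℝ 1 (pd k (gmat g11 g12 g22 a b)) Ω := fun k a b =>
    (hg.contDiffOn_gmat a b).pd hΩ (by norm_num) k
  refine contDiffOn_const.mul (ContDiffOn.sum fun m _ => ?_)
  exact ((hg.contDiffOn_ginv l m).of_le (by norm_num)).mul
    (((hpd i j m).add (hpd j i m)).sub (hpd m i j))

lemma IsMetricOn.sum_gmat_mul_ginv (hg : IsMetricOn g11 g12 g22 Ω) (hp : p ∈ Ω)
    (l m : Fin 2) :
    gmat g11 g12 g22 l 0 p * ginv g11 g12 g22 0 m p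
      + gmat g11 g12 g22 l 1 p * ginv g11 g12 g22 1 m p = if l = m then 1 else 0 := by
  have hD := hg.gdet_ne_zero hp
  fin_cases l <;> fin_cases m <;> simp [gmat, ginv] <;> field_simp <;> simp only [gdet] <;> ring

/-- Lowering the upper index of the Christoffel symbols. -/
lemma IsMetricOn.sum_gmat_mul_Chr (hg : IsMetricOn g11 g12 g22 Ω) (hp : p ∈ Ω)
    (l i j : Fin 2) :
    gmat g11 g12 g22 l 0 p * Chr g11 g12 g22 0 i j p
      + gmat g11 g12 g22 l 1 p * Chr g11 g12 g22 1 i j p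
      = 1 / 2 * (pd i (gmat g11 g12 g22 j l) p + pd j (gmat g11 g12 g22 i l) p
          - pd l (gmat g11 g12 g22 i j) p) := by
  have h0 := hg.sum_gmat_mul_ginv hp l 0
  have h1 := hg.sum_gmat_mul_ginv hp l 1
  simp only [Chr, Fin.sum_univ_two]
  fin_cases l <;>
    simp only [Fin.zero_eta, Fin.mk_one, if_true, one_ne_zero, zero_ne_one, if_false]
      at h0 h1 ⊢ <;>
    linear_combination
      1 / 2 * (pd i (gmat g11 g12 g22 j 0) p + pd j (gmat g11 g12 g22 i 0) p
        - pd 0 (gmat g11 g12 g22 i j) p) * h0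
      + 1 / 2 * (pd i (gmat g11 g12 g22 j 1) p + pd j (gmat g11 g12 g22 i 1) p
        - pd 1 (gmat g11 g12 g22 i j) p) * h1

/-- The metric is parallel. -/
lemma IsMetricOn.pd_gmat (hg : IsMetricOn g11 g12 g22 Ω) (hp : p ∈ Ω) (k i j : Fin 2) :
    pd k (gmat g11 g12 g22 i j) p =
      gmat g11 g12 g22 j 0 p * Chr g11 g12 g22 0 k i p
      + gmat g11 g12 g22 j 1 p * Chr g11 g12 g22 1 k i p
      + (gmat g11 g12 g22 i 0 p * Chr g11 g12 g22 0 k j p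
      + gmat g11 g12 g22 i 1 p * Chr g11 g12 g22 1 k j p) := by
  rw [hg.sum_gmat_mul_Chr hp, hg.sum_gmat_mul_Chr hp, gmat_symm j i]
  ring

lemma IsMetricOn.pd_gdet (hΩ : IsOpen Ω) (hg : IsMetricOn g11 g12 g22 Ω) (hp : p ∈ Ω)
    (k : Fin 2) : pd k (gdet g11 g12 g22) p =
      2 * gdet g11 g12 g22 p * (Chr g11 g12 g22 0 k 0 p + Chr g11 g12 g22 1 k 1 p) := by
  have hd : ∀ i j, DifferentiableAt ℝ (gmat g11 g12 g22 i j) p := fun i j =>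
    (hg.contDiffOn_gmat i j).differentiableAt_of_mem hΩ two_ne_zero hp
  have h : pd k (gdet g11 g12 g22) p = pd k (fun q => gmat g11 g12 g22 0 0 q *
      gmat g11 g12 g22 1 1 q - gmat g11 g12 g22 0 1 q * gmat g11 g12 g22 0 1 q) p :=
    pd_congr k hΩ hp fun q _ => by rw [gdet_eq_gmat, sq]
  rw [h, pd_sub k ((hd 0 0).fun_mul (hd 1 1)) ((hd 0 1).fun_mul (hd 0 1)), pd_mul k (hd 0 0) (hd 1 1),
    pd_mul k (hd 0 1) (hd 0 1), hg.pd_gmat hp k 0 0, hg.pd_gmat hp k 0 1, hg.pd_gmat hp k 1 1,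
    gdet_eq_gmat, gmat_symm 1 0]
  ring

lemma IsMetricOn.sum_gmat_mul_pd_Chr (hΩ : IsOpen Ω) (hg : IsMetricOn g11 g12 g22 Ω)
    (hp : p ∈ Ω) (k l i j : Fin 2) :
    pd k (gmat g11 g12 g22 l 0) p * Chr g11 g12 g22 0 i j p
      + gmat g11 g12 g22 l 0 p * pd k (Chr g11 g12 g22 0 i j) p
      + (pd k (gmat g11 g12 g22 l 1) p * Chr g11 g12 g22 1 i j p
      + gmat g11 g12 g22 l 1 p * pd k (Chr g11 g12 g22 1 i j) p)
      = 1 / 2 * (pd k (pd i (gmat g11 g12 g22 j l)) p + pd k (pd j (gmat g11 g12 g22 i l)) p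
          - pd k (pd l (gmat g11 g12 g22 i j)) p) := by
  have hd : ∀ i j, DifferentiableAt ℝ (gmat g11 g12 g22 i j) p := fun i j =>
    (hg.contDiffOn_gmat i j).differentiableAt_of_mem hΩ two_ne_zero hp
  have hdd : ∀ m i j, DifferentiableAt ℝ (pd m (gmat g11 g12 g22 i j)) p := fun m i j =>
    ((hg.contDiffOn_gmat i j).pd (m := 1) hΩ (by norm_num) m).differentiableAt_of_mem hΩ
      one_ne_zero hp
  have hC : ∀ l i j, DifferentiableAt ℝ (Chr g11 g12 g22 l i j) p := fun l i j =>
    (hg.contDiffOn_Chr hΩ l i j).differentiableAt_of_mem hΩ one_ne_zero hp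
  have h := pd_congr k hΩ hp fun q hq => hg.sum_gmat_mul_Chr hq l i j
  rwa [pd_add k ((hd l 0).fun_mul (hC 0 i j)) ((hd l 1).fun_mul (hC 1 i j)), pd_mul k (hd l 0) (hC 0 i j),
    pd_mul k (hd l 1) (hC 1 i j),
    pd_const_mul k _ (((hdd i j l).fun_add (hdd j i l)).fun_sub (hdd l i j)),
    pd_sub k ((hdd i j l).fun_add (hdd j i l)) (hdd l i j), pd_add k (hdd i j l) (hdd j i l)] at h

/-- Antisymmetry of the fully covariant curvature tensor in its first pair of indices. -/
lemma IsMetricOn.riemann_antisymm (hΩ : IsOpen Ω) (hg : IsMetricOn g11 g12 g22 Ω)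
    (hp : p ∈ Ω) (m k : Fin 2) :
    gmat g11 g12 g22 m 0 p * riemann g11 g12 g22 0 k p
      + gmat g11 g12 g22 m 1 p * riemann g11 g12 g22 1 k p
      + (gmat g11 g12 g22 k 0 p * riemann g11 g12 g22 0 m p
      + gmat g11 g12 g22 k 1 p * riemann g11 g12 g22 1 m p) = 0 := by
  have e1 := hg.sum_gmat_mul_pd_Chr hΩ hp 0 m 1 k
  have e2 := hg.sum_gmat_mul_pd_Chr hΩ hp 1 m 0 k
  have e3 := hg.sum_gmat_mul_pd_Chr hΩ hp 0 k 1 m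
  have e4 := hg.sum_gmat_mul_pd_Chr hΩ hp 1 k 0 m
  have hc := pd_comm hΩ (hg.contDiffOn_gmat k m) hp 0 1
  simp only [hg.pd_gmat hp, gmat_symm m k, gmat_symm 1 0, Chr_symm _ 1 0] at e1 e2 e3 e4
  simp only [riemann, Fin.sum_univ_two, Chr_symm _ 1 0]
  linear_combination e1 - e2 + e3 - e4 + hc

/-- In dimension two the curvature tensor is determined by the Gaussian curvature. -/
lemma IsMetricOn.riemann_eq (hΩ : IsOpen Ω) (hg : IsMetricOn g11 g12 g22 Ω) (hp : p ∈ Ω) :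
    riemann g11 g12 g22 0 1 p = GaussK g11 g12 g22 p * g22 p ∧
    riemann g11 g12 g22 1 1 p = -GaussK g11 g12 g22 p * g12 p ∧
    riemann g11 g12 g22 0 0 p = GaussK g11 g12 g22 p * g12 p ∧
    riemann g11 g12 g22 1 0 p = -GaussK g11 g12 g22 p * g11 p := by
  have hD := hg.gdet_ne_zero hp
  have hK : GaussK g11 g12 g22 p * gdet g11 g12 g22 p =
      g11 p * riemann g11 g12 g22 0 1 p + g12 p * riemann g11 g12 g22 1 1 p := by
    rw [GaussK, one_div, mul_comm, mul_inv_cancel_left₀ hD, Fin.sum_univ_two]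
    rfl
  have h00 : g11 p * riemann g11 g12 g22 0 0 p + g12 p * riemann g11 g12 g22 1 0 p
    + (g11 p * riemann g11 g12 g22 0 0 p + g12 p * riemann g11 g12 g22 1 0 p) = 0 :=
    hg.riemann_antisymm hΩ hp 0 0
  have h01 : g11 p * riemann g11 g12 g22 0 1 p + g12 p * riemann g11 g12 g22 1 1 p
    + (g12 p * riemann g11 g12 g22 0 0 p + g22 p * riemann g11 g12 g22 1 0 p) = 0 :=
    hg.riemann_antisymm hΩ hp 0 1
  have h11 : g12 p * riemann g11 g12 g22 0 1 p + g22 p * riemann g11 g12 g22 1 1 p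
    + (g12 p * riemann g11 g12 g22 0 1 p + g22 p * riemann g11 g12 g22 1 1 p) = 0 :=
    hg.riemann_antisymm hΩ hp 1 1
  have hdet : gdet g11 g12 g22 p = g11 p * g22 p - g12 p ^ 2 := rfl
  refine ⟨?_, ?_, ?_, ?_⟩ <;> refine mul_right_cancel₀ hD ?_
  · linear_combination riemann g11 g12 g22 0 1 p * hdet - g22 p * hK - g12 p / 2 * h11
  · linear_combination riemann g11 g12 g22 1 1 p * hdet + g12 p * hK + g11 p / 2 * h11
  · linear_combination riemann g11 g12 g22 0 0 p * hdet - g12 p * hK + g22 p / 2 * h00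
      - g12 p * h01
  · linear_combination riemann g11 g12 g22 1 0 p * hdet + g11 p * hK - g12 p / 2 * h00
      + g11 p * h01

lemma IsMetricOn.contDiffOn_cov2 (hΩ : IsOpen Ω) (hg : IsMetricOn g11 g12 g22 Ω)
    (hz : ContDiffOn ℝ 3 z Ω) (i j : Fin 2) : ContDiffOn ℝ 1 (cov2 g11 g12 g22 z i j) Ω := by
  have hz1 : ∀ k, ContDiffOn ℝ 2 (pd k z) Ω := hz.pd hΩ (by norm_num)
  exact ((hz1 j).pd hΩ (by norm_num) i).sub (ContDiffOn.sum fun l _ =>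
    (hg.contDiffOn_Chr hΩ l i j).mul ((hz1 l).of_le (by norm_num)))

lemma IsMetricOn.pd_cov2 (hΩ : IsOpen Ω) (hg : IsMetricOn g11 g12 g22 Ω)
    (hz : ContDiffOn ℝ 3 z Ω) (hp : p ∈ Ω) (k i j : Fin 2) :
    pd k (cov2 g11 g12 g22 z i j) p = pd k (pd i (pd j z)) p
      - (pd k (Chr g11 g12 g22 0 i j) p * pd 0 z p + Chr g11 g12 g22 0 i j p * pd k (pd 0 z) p
      + (pd k (Chr g11 g12 g22 1 i j) p * pd 1 z p
      + Chr g11 g12 g22 1 i j p * pd k (pd 1 z) p)) := by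
  have hz1 : ∀ k, ContDiffOn ℝ 2 (pd k z) Ω := hz.pd hΩ (by norm_num)
  have d1 : ∀ k, DifferentiableAt ℝ (pd k z) p := fun k =>
    (hz1 k).differentiableAt_of_mem hΩ two_ne_zero hp
  have d2 : DifferentiableAt ℝ (pd i (pd j z)) p :=
    ((hz1 j).pd (m := 1) hΩ (by norm_num) i).differentiableAt_of_mem hΩ one_ne_zero hp
  have hC : ∀ l, DifferentiableAt ℝ (Chr g11 g12 g22 l i j) p := fun l =>
    (hg.contDiffOn_Chr hΩ l i j).differentiableAt_of_mem hΩ one_ne_zero hp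
  have h : pd k (cov2 g11 g12 g22 z i j) p = pd k (fun q => pd i (pd j z) q -
      (Chr g11 g12 g22 0 i j q * pd 0 z q + Chr g11 g12 g22 1 i j q * pd 1 z q)) p :=
    pd_congr k hΩ hp fun q _ => by rw [cov2, Fin.sum_univ_two]
  rw [h, pd_sub k d2 (((hC 0).fun_mul (d1 0)).fun_add ((hC 1).fun_mul (d1 1))),
    pd_add k ((hC 0).fun_mul (d1 0)) ((hC 1).fun_mul (d1 1)), pd_mul k (hC 0) (d1 0),
    pd_mul k (hC 1) (d1 1)]

lemma IsMetricOn.pd_div_gdet (hΩ : IsOpen Ω) (hg : IsMetricOn g11 g12 g22 Ω) (hp : p ∈ Ω)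
    {f : ℝ × ℝ → ℝ} (hf : ContDiffOn ℝ 1 f Ω) (k : Fin 2) :
    pd k (fun q => f q / gdet g11 g12 g22 q) p = (pd k f p
      - 2 * f p * (Chr g11 g12 g22 0 k 0 p + Chr g11 g12 g22 1 k 1 p)) / gdet g11 g12 g22 p := by
  have hD := hg.gdet_ne_zero hp
  have hq : DifferentiableAt ℝ (fun q => f q / gdet g11 g12 g22 q) p :=
    (hf.div (hg.contDiffOn_gdet.of_le (by norm_num)) fun q hq =>
      hg.gdet_ne_zero hq).differentiableAt_of_mem hΩ one_ne_zero hp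
  have h := pd_congr k hΩ hp fun q hq =>
    (div_mul_cancel₀ (f q) (hg.gdet_ne_zero hq))
  rw [pd_mul k hq (hg.contDiffOn_gdet.differentiableAt_of_mem hΩ two_ne_zero hp),
    hg.pd_gdet hΩ hp] at h
  rw [eq_div_iff hD, ← h]
  field_simp
  ring

end Metric

theorem divergence_of_b
    (Ω : Set (ℝ × ℝ)) (hΩ : IsOpen Ω)
    (g11 g12 g22 : ℝ × ℝ → ℝ) (hg : IsMetricOn g11 g12 g22 Ω)
    (z : ℝ × ℝ → ℝ) (hz : ContDiffOn ℝ 3 z Ω) :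
    ∀ j : Fin 2, ∀ p ∈ Ω,
      divb g11 g12 g22 z j p
        = -GaussK g11 g12 g22 p * ∑ l : Fin 2, ginv g11 g12 g22 j l p * pd l z p := by
  intro j p hp
  have hD := hg.gdet_ne_zero hp
  have hc := hg.contDiffOn_cov2 hΩ hz
  obtain ⟨r01, r11, r00, r10⟩ := hg.riemann_eq hΩ hp
  have hz1 : ∀ k, ContDiffOn ℝ 2 (pd k z) Ω := hz.pd hΩ (by norm_num)
  have s1 : pd 1 (pd 0 z) p = pd 0 (pd 1 z) p :=
    pd_comm hΩ (hz.of_le (by norm_num)) hp 1 0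
  have s2 : ∀ k, pd 1 (pd 0 (pd k z)) p = pd 0 (pd 1 (pd k z)) p := fun k =>
    pd_comm hΩ (hz1 k) hp 1 0
  have s3 : pd 0 (pd 1 (pd 0 z)) p = pd 0 (pd 0 (pd 1 z)) p :=
    pd_congr 0 hΩ hp fun q hq => pd_comm hΩ (hz.of_le (by norm_num)) hq 1 0
  have b00 (k : Fin 2) := (show pd k (bmat g11 g12 g22 z 0 0) p =
    pd k (fun q => cov2 g11 g12 g22 z 1 1 q / gdet g11 g12 g22 q) p from rfl).trans
      (hg.pd_div_gdet hΩ hp (hc 1 1) k)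
  have b01 (k : Fin 2) := (show pd k (bmat g11 g12 g22 z 0 1) p =
    pd k (fun q => -cov2 g11 g12 g22 z 0 1 q / gdet g11 g12 g22 q) p from rfl).trans
      (hg.pd_div_gdet hΩ hp (hc 0 1).neg k)
  have b10 (k : Fin 2) := (show pd k (bmat g11 g12 g22 z 1 0) p =
    pd k (fun q => -cov2 g11 g12 g22 z 0 1 q / gdet g11 g12 g22 q) p from rfl).trans
      (hg.pd_div_gdet hΩ hp (hc 0 1).neg k)
  have b11 (k : Fin 2) := (show pd k (bmat g11 g12 g22 z 1 1) p =
    pd k (fun q => cov2 g11 g12 g22 z 0 0 q / gdet g11 g12 g22 q) p from rfl).trans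
      (hg.pd_div_gdet hΩ hp (hc 0 0) k)
  simp only [pd_neg, hg.pd_cov2 hΩ hz hp] at b00 b01 b10 b11
  simp only [riemann, Fin.sum_univ_two, Chr_symm _ 1 0] at r01 r11 r00 r10
  fin_cases j <;>
    simp only [Fin.zero_eta, Fin.mk_one, divb, Fin.sum_univ_two, b00, b01, b10, b11, bmat, ginv,
      cov2, if_true, one_ne_zero, if_false, s1, s2, s3, Chr_symm _ 1 0] <;>
    field_simp
  · linear_combination (-pd 0 z p) * r01 - pd 1 z p * r11
  · linear_combination (pd 0 z p) * r00 + pd 1 z p * r10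

end
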